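/- Let n ≥ 3 and k ≥ 1. The cycle graph C_n is Z_{2^k}-AW if and only if n ≡ 1 or 2 (mod 3). -/

import Mathlib

-- Toggling a vertex `v` in the `ZMod m`-labeling lights out game:
-- the label of `v` is added to the labels of `v` and all its neighbors.
open Classical in
noncomputable def gToggle {V : Type*} (G : SimpleGraph V) {m : ℕ} (v : V)
    (lab : V → ZMod m) : V → ZMod m :=
  fun w => if w = v ∨ G.Adj v w then lab v + lab w else lab w

/-- The result of toggling, in order, the vertices in the list `L`
in the `ZMod m`-labeling lights out game. -/
noncomputable def gPlay {V : Type*} (G : SimpleGraph V) {m : ℕ} (L : List V)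
    (lab : V → ZMod m) : V → ZMod m :=
  L.foldl (fun l v => gToggle G v l) lab

/-- A labeling is winnable in the `ZMod m`-labeling lights out game if some
finite sequence of toggles transforms it into the zero labeling. -/
def gWinnable {V : Type*} (G : SimpleGraph V) {m : ℕ} (lab : V → ZMod m) : Prop :=
  ∃ L : List V, gPlay G L lab = 0

/-- `G` is `ZMod m`-Always Winnable: every labeling is winnable
in the `ZMod m`-labeling lights out game. -/
def gAW {V : Type*} (G : SimpleGraph V) (m : ℕ) : Prop :=
  ∀ lab : V → ZMod m, gWinnable G lab

-- Toggling a vertex `v` in the neighborhood `m`-lights out game: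
-- the labels of `v` and all its neighbors are increased by `1`.
open Classical in
noncomputable def nToggle {V : Type*} (G : SimpleGraph V) {m : ℕ} (v : V)
    (lab : V → ZMod m) : V → ZMod m :=
  fun w => if w = v ∨ G.Adj v w then lab w + 1 else lab w

/-- The result of toggling, in order, the vertices in the list `L`
in the neighborhood `m`-lights out game. -/
noncomputable def nPlay {V : Type*} (G : SimpleGraph V) {m : ℕ} (L : List V)
    (lab : V → ZMod m) : V → ZMod m :=
  L.foldl (fun l v => nToggle G v l) lab

/-- A labeling is `(N,m)`-winnable if some finite sequence of toggles in the
neighborhood `m`-lights out game transforms it into the zero labeling. -/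
def nWinnable {V : Type*} (G : SimpleGraph V) {m : ℕ} (lab : V → ZMod m) : Prop :=
  ∃ L : List V, nPlay G L lab = 0

/-- `G` is `(N,m)`-Always Winnable: every labeling is winnable
in the neighborhood `m`-lights out game. -/
def nAW {V : Type*} (G : SimpleGraph V) (m : ℕ) : Prop :=
  ∀ lab : V → ZMod m, nWinnable G lab

/-- The parity of an element of `ZMod n`, as an element of `ZMod 2`:
`1` if its representatives are odd, `0` if they are even. -/
def parity {n : ℕ} (x : ZMod n) : ZMod 2 :=
  if x.val % 2 = 1 then 1 else 0

section Game

variable {V : Type*} (G : SimpleGraph V)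

theorem gPlay_append {m : ℕ} (L₁ L₂ : List V) (lab : V → ZMod m) :
    gPlay G (L₁ ++ L₂) lab = gPlay G L₂ (gPlay G L₁ lab) := by
  simp [gPlay]

theorem gPlay_map {m m' : ℕ} (φ : ZMod m →+ ZMod m') (L : List V) (lab : V → ZMod m) :
    gPlay G L (fun v => φ (lab v)) = fun v => φ (gPlay G L lab v) := by
  induction L generalizing lab with
  | nil => rfl
  | cons v L ih =>
    have h : gToggle G v (fun v => φ (lab v)) = fun w => φ (gToggle G v lab w) := by
      funext w
      simp only [gToggle]
      split_ifs <;> simp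
    simp only [gPlay, List.foldl_cons] at ih ⊢
    rw [h, ih]

/-- `lab'` is obtained from `lab` by some finite sequence of toggles. -/
def Reaches {m : ℕ} (lab lab' : V → ZMod m) : Prop :=
  ∃ L : List V, gPlay G L lab = lab'

variable {G}

theorem Reaches.refl {m : ℕ} (lab : V → ZMod m) : Reaches G lab lab := ⟨[], rfl⟩

theorem Reaches.trans {m : ℕ} {a b c : V → ZMod m} (h₁ : Reaches G a b)
    (h₂ : Reaches G b c) : Reaches G a c := by
  obtain ⟨L₁, rfl⟩ := h₁
  obtain ⟨L₂, rfl⟩ := h₂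
  exact ⟨L₁ ++ L₂, gPlay_append G L₁ L₂ a⟩

theorem Reaches.winnable {m : ℕ} {a b : V → ZMod m} (h₁ : Reaches G a b)
    (h₂ : gWinnable G b) : gWinnable G a :=
  Reaches.trans h₁ h₂

theorem double_pow_eq_zero (k : ℕ) :
    zmultiplesHom (ZMod (2 ^ (k + 1))) 2 (2 ^ k : ℕ) = 0 := by
  have h := ZMod.natCast_self (2 ^ (k + 1))
  rw [pow_succ, Nat.cast_mul] at h
  rw [zmultiplesHom_apply, natCast_zsmul, nsmul_eq_mul]
  exact h

/-- Doubling, as an additive map from `ZMod (2 ^ k)` to `ZMod (2 ^ (k + 1))`. -/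
def doubleHom (k : ℕ) : ZMod (2 ^ k) →+ ZMod (2 ^ (k + 1)) :=
  ZMod.lift (2 ^ k) ⟨zmultiplesHom _ 2, double_pow_eq_zero k⟩

theorem doubleHom_natCast (k c : ℕ) :
    doubleHom k (c : ZMod (2 ^ k)) = ((c * 2 : ℕ) : ZMod (2 ^ (k + 1))) := by
  have h := ZMod.lift_coe (2 ^ k) (⟨zmultiplesHom (ZMod (2 ^ (k + 1))) 2, double_pow_eq_zero k⟩ : {f : ℤ →+ ZMod (2 ^ (k + 1)) // f (2 ^ k : ℕ) = 0}) (c : ℤ)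
  simpa [doubleHom] using h

theorem gAW_two_pow_of_gAW_two (h : gAW G 2) (k : ℕ) : gAW G (2 ^ k) := by
  induction k with
  | zero =>
    intro lab
    refine ⟨[], funext fun v => ?_⟩
    have : Subsingleton (ZMod (2 ^ 0)) := inferInstanceAs (Subsingleton (ZMod 1))
    exact Subsingleton.elim _ _
  | succ k ih =>
    intro lab
    have hd : 2 ∣ 2 ^ (k + 1) := ⟨2 ^ k, by ring⟩
    obtain ⟨L, hL⟩ := h fun v => (ZMod.castHom hd (ZMod 2)).toAddMonoidHom (lab v)
    rw [gPlay_map] at hL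
    set μ := gPlay G L lab with hμ
    have hhalf : μ = fun v => doubleHom k (((μ v).val / 2 : ℕ) : ZMod (2 ^ k)) := by
      funext v
      have h0 := congrFun hL v
      simp only [Pi.zero_apply, RingHom.toAddMonoidHom_eq_coe, AddMonoidHom.coe_coe,
        ZMod.castHom_apply, ZMod.cast_eq_val] at h0
      rw [ZMod.natCast_eq_zero_iff] at h0
      rw [doubleHom_natCast, Nat.div_mul_cancel h0, ZMod.natCast_zmod_val]
    obtain ⟨L', hL'⟩ := ih fun v => (((μ v).val / 2 : ℕ) : ZMod (2 ^ k))
    refine Reaches.winnable ⟨L, rfl⟩ ⟨L', ?_⟩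
    rw [← hμ, hhalf, gPlay_map, hL']
    funext v
    simp

theorem gAW_two_of_gAW_two_pow {k : ℕ} (hk : 1 ≤ k) (h : gAW G (2 ^ k)) : gAW G 2 := by
  intro lab
  have hd : 2 ∣ 2 ^ k := dvd_pow_self 2 (by omega)
  obtain ⟨L, hL⟩ := h fun v => ((lab v).val : ZMod (2 ^ k))
  refine ⟨L, ?_⟩
  have hm := gPlay_map G (ZMod.castHom hd (ZMod 2)).toAddMonoidHom L
    fun v => ((lab v).val : ZMod (2 ^ k))
  rw [hL] at hm
  simpa [Pi.zero_def] using hm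

end Game

section Cycle

variable {n : ℕ}

/-- The indicator of the vertex `v`. -/
def vertexInd (v : ZMod n) : ZMod n → ZMod 2 := Pi.single v 1

theorem vertexInd_apply (v w : ZMod n) : vertexInd v w = if w = v then 1 else 0 := by
  simp [vertexInd, Pi.single_apply]

/-- Adjacency of `G` is that of the cycle on `ZMod n`. -/
def IsCycleOn (G : SimpleGraph (ZMod n)) : Prop :=
  ∀ u v, G.Adj u v ↔ u - v = 1 ∨ v - u = 1

theorem zmod_natCast_ne_zero {c : ℕ} (hc : 0 < c) (hn : c < n) : (c : ZMod n) ≠ 0 := by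
  rw [Ne, ZMod.natCast_eq_zero_iff]
  exact Nat.not_dvd_of_pos_of_lt hc hn

variable {G : SimpleGraph (ZMod n)}

theorem gToggle_cycle (hG : IsCycleOn G) (hn : 3 ≤ n) (v : ZMod n)
    (lab : ZMod n → ZMod 2) :
    gToggle G v lab =
      lab + lab v • (vertexInd v + vertexInd (v + 1) + vertexInd (v - 1)) := by
  have h1 : (1 : ZMod n) ≠ 0 := by exact_mod_cast zmod_natCast_ne_zero (n := n) one_pos (by omega)
  have h2 : (2 : ZMod n) ≠ 0 := by exact_mod_cast zmod_natCast_ne_zero (n := n) two_pos (by omega)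
  funext w
  simp only [gToggle, hG v w, Pi.add_apply, Pi.smul_apply, vertexInd_apply, smul_eq_mul]
  grind

theorem reaches_toggle (hG : IsCycleOn G) (hn : 3 ≤ n) {v : ZMod n}
    {lab : ZMod n → ZMod 2} (hv : lab v = 1) :
    Reaches G lab (lab + (vertexInd v + vertexInd (v + 1) + vertexInd (v - 1))) :=
  ⟨[v], by simp [gPlay, gToggle_cycle hG hn, hv]⟩

theorem not_gAW_of_three_dvd (hG : IsCycleOn G) (hn : 3 ≤ n) (h3 : 3 ∣ n) : ¬ gAW G 2 := by
  have : NeZero n := ⟨by omega⟩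
  intro h
  set c := ZMod.castHom h3 (ZMod 3)
  let wt : ZMod 3 → ZMod 2 := fun x => if x = 0 then 0 else 1
  have hwt : ∀ x, wt x + wt (x + 1) + wt (x - 1) = 0 := by decide
  let F : (ZMod n → ZMod 2) → ZMod 2 := fun lab => ∑ v, lab v * wt (c v)
  have hadd : ∀ a b, F (a + b) = F a + F b := fun a b => by
    simp [F, add_mul, Finset.sum_add_distrib]
  have hsmul : ∀ (r : ZMod 2) a, F (r • a) = r * F a := fun r a => by
    simp [F, Finset.mul_sum, mul_assoc]
  have hind : ∀ v, F (vertexInd v) = wt (c v) := fun v => by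
    simp [F, vertexInd_apply]
  have hinv : ∀ (L : List (ZMod n)) lab, F (gPlay G L lab) = F lab := by
    intro L
    induction L with
    | nil => intro lab; rfl
    | cons v L ih =>
      intro lab
      have := ih (gToggle G v lab)
      simp only [gPlay, List.foldl_cons] at this ⊢
      rw [this, gToggle_cycle hG hn, hadd, hsmul, hadd, hadd, hind, hind, hind, map_add,
        map_sub, map_one, hwt, mul_zero, add_zero]
  obtain ⟨L, hL⟩ := h (vertexInd 1)
  have h1 := hinv L (vertexInd 1)
  rw [hL, hind, map_one] at h1
  simp [F, wt] at h1

theorem offset_eq (b : ZMod n) : b + 1 + 1 = b + 2 ∧ b + 2 + 1 = b + 3 ∧ b + 2 - 1 = b + 1 ∧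
    b + 1 - 1 = b := by
  refine ⟨?_, ?_, ?_, ?_⟩ <;> ring

theorem offset_ne (hn : 4 ≤ n) (b : ZMod n) : b + 1 ≠ b ∧ b + 2 ≠ b ∧ b + 3 ≠ b ∧
    b + 2 ≠ b + 1 ∧ b + 3 ≠ b + 1 ∧ b + 3 ≠ b + 2 ∧ b - 1 ≠ b ∧ b - 1 ≠ b + 1 ∧
    b - 1 ≠ b + 2 := by
  have n1 : (1 : ZMod n) ≠ 0 := by exact_mod_cast zmod_natCast_ne_zero (n := n) one_pos (by omega)
  have n2 : (2 : ZMod n) ≠ 0 := by exact_mod_cast zmod_natCast_ne_zero (n := n) two_pos (by omega)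
  have n3 : (3 : ZMod n) ≠ 0 := by exact_mod_cast zmod_natCast_ne_zero (n := n) three_pos (by omega)
  refine ⟨fun h => n1 ?_, fun h => n2 ?_, fun h => n3 ?_, fun h => n1 ?_, fun h => n2 ?_,
    fun h => n1 ?_, fun h => n1 ?_, fun h => n2 ?_, fun h => n3 ?_⟩
  all_goals first | linear_combination h | linear_combination -h

/-- A lit vertex followed by two unlit ones can be moved forward by three. -/
theorem reaches_shift (hG : IsCycleOn G) (hn : 4 ≤ n) {b : ZMod n}
    {lab : ZMod n → ZMod 2} (h0 : lab b = 1) (h1 : lab (b + 1) = 0) (h2 : lab (b + 2) = 0) :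
    Reaches G lab (lab + vertexInd b + vertexInd (b + 3)) := by
  have hne := offset_ne hn b
  obtain ⟨e1, e2, e3, e4⟩ := offset_eq b
  refine (reaches_toggle hG (by omega) h0).trans ?_
  refine (reaches_toggle hG (by omega) (v := b + 1) ?_).trans ?_
  · simp only [Pi.add_apply, vertexInd_apply]; grind
  rw [e1, e4]
  refine (reaches_toggle hG (by omega) (v := b) ?_).trans ?_
  · simp only [Pi.add_apply, vertexInd_apply]; grind
  refine (reaches_toggle hG (by omega) (v := b + 2) ?_).trans ?_
  · simp only [Pi.add_apply, vertexInd_apply]; grind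
  rw [e2, e3]
  convert Reaches.refl _ using 1
  funext w
  simp only [Pi.add_apply]
  grind

theorem reaches_shift_iterate (hG : IsCycleOn G) (hn : 4 ≤ n) {q : ZMod n}
    {μ : ZMod n → ZMod 2} (j : ℕ) (h : ∀ i : ℕ, i < 3 * j → μ (q + (i : ZMod n)) = 0) :
    Reaches G (μ + vertexInd q) (μ + vertexInd (q + ((3 * j : ℕ) : ZMod n))) := by
  induction j with
  | zero => simpa using Reaches.refl (G := G) (μ + vertexInd q)
  | succ j ih =>
    refine (ih fun i hi => h i (by omega)).trans ?_
    have a0 := h (3 * j) (by omega)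
    have a1 := h (3 * j + 1) (by omega)
    have a2 := h (3 * j + 2) (by omega)
    have e : q + ((3 * (j + 1) : ℕ) : ZMod n) = q + ((3 * j : ℕ) : ZMod n) + 3 := by
      push_cast; ring
    rw [e]
    rw [Nat.cast_add, ← add_assoc] at a1 a2
    rw [Nat.cast_one] at a1
    rw [Nat.cast_ofNat] at a2
    generalize q + ((3 * j : ℕ) : ZMod n) = b at *
    have hne := offset_ne hn b
    have hs := reaches_shift hG hn (b := b) (lab := μ + vertexInd b)
      (by simp [vertexInd_apply, a0]) (by simp [vertexInd_apply, a1, hne])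
      (by simp [vertexInd_apply, a2, hne])
    rwa [add_assoc μ, CharTwo.add_self_eq_zero, add_zero] at hs

/-- A vertex can be turned off while changing only the next three vertices. -/
theorem exists_reaches_clear (hG : IsCycleOn G) (hn : 4 ≤ n) (b : ZMod n)
    (lab : ZMod n → ZMod 2) :
    ∃ lab', Reaches G lab lab' ∧ lab' b = 0 ∧
      ∀ w, w ≠ b → w ≠ b + 1 → w ≠ b + 2 → w ≠ b + 3 → lab' w = lab w := by
  have hne := offset_ne hn b
  obtain ⟨e1, e2, e3, e4⟩ := offset_eq b
  have h01 : ∀ x : ZMod 2, x = 0 ∨ x = 1 := by decide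
  rcases h01 (lab b) with h0 | h0
  · exact ⟨lab, Reaches.refl lab, h0, fun _ _ _ _ _ => rfl⟩
  rcases h01 (lab (b + 1)) with h1 | h1
  · rcases h01 (lab (b + 2)) with h2 | h2
    · refine ⟨_, reaches_shift hG hn h0 h1 h2, ?_, fun w _ _ _ _ => ?_⟩ <;>
        simp only [Pi.add_apply, vertexInd_apply] <;> grind
    · refine ⟨_, (reaches_toggle hG (by omega) h2).trans
        (reaches_toggle hG (by omega) (v := b + 1) ?_), ?_, fun w _ _ _ _ => ?_⟩ <;>
        simp only [e1, e2, e3, e4, Pi.add_apply, vertexInd_apply] <;> grind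
  · refine ⟨_, reaches_toggle hG (by omega) h1, ?_, fun w _ _ _ _ => ?_⟩ <;>
      simp only [e1, e4, Pi.add_apply, vertexInd_apply] <;> grind

theorem natCast_inj_of_lt {i j : ℕ} (hi : i < n) (hj : j < n) :
    (i : ZMod n) = (j : ZMod n) ↔ i = j := by
  rw [ZMod.natCast_eq_natCast_iff', Nat.mod_eq_of_lt hi, Nat.mod_eq_of_lt hj]

theorem exists_reaches_sweep (hG : IsCycleOn G) (hn : 4 ≤ n) (lab : ZMod n → ZMod 2)
    (j : ℕ) (hj : j + 3 ≤ n) :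
    ∃ lab', Reaches G lab lab' ∧ ∀ i : ℕ, i < j → lab' (i : ZMod n) = 0 := by
  induction j with
  | zero => exact ⟨lab, Reaches.refl lab, fun i hi => absurd hi (by omega)⟩
  | succ j ih =>
    obtain ⟨μ, hμ, hμ0⟩ := ih (by omega)
    obtain ⟨ν, hν, hν0, hνμ⟩ := exists_reaches_clear hG hn (j : ZMod n) μ
    refine ⟨ν, hμ.trans hν, fun i hi => ?_⟩
    rcases Nat.lt_succ_iff_lt_or_eq.mp hi with hij | rfl
    · rw [hνμ, hμ0 i hij]
      · rw [Ne, natCast_inj_of_lt (by omega) (by omega)]; omega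
      · rw [← Nat.cast_one, ← Nat.cast_add, Ne, natCast_inj_of_lt (by omega) (by omega)]; omega
      · rw [← Nat.cast_ofNat, ← Nat.cast_add, Ne, natCast_inj_of_lt (by omega) (by omega)]; omega
      · rw [← Nat.cast_ofNat, ← Nat.cast_add, Ne, natCast_inj_of_lt (by omega) (by omega)]; omega
    · exact hν0

theorem gWinnable_vertexInd (hG : IsCycleOn G) (hn : 4 ≤ n) (h3 : n % 3 = 1 ∨ n % 3 = 2)
    (a : ZMod n) : gWinnable G (vertexInd (a + 1)) := by
  have hne := offset_ne hn a
  obtain ⟨e1, e2, e3, e4⟩ := offset_eq a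
  have hfar : ∀ c i : ℕ, 0 < c + i → c + i < n → a + (c : ZMod n) + (i : ZMod n) ≠ a := by
    intro c i h0 hi h
    apply zmod_natCast_ne_zero h0 hi
    push_cast
    linear_combination h
  have hstart : Reaches G (vertexInd (a + 1)) (vertexInd a + vertexInd (a + 2)) := by
    convert reaches_toggle hG (by omega) (v := a + 1) (lab := vertexInd (a + 1)) ?_ using 1
    · rw [e1, e4]
      funext w
      simp only [Pi.add_apply]
      grind
    · simp [vertexInd_apply]
  refine hstart.winnable ?_
  rcases h3 with h3 | h3
  · have hnext : Reaches G (vertexInd a + vertexInd (a + 2))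
        (vertexInd a + vertexInd (a + 1) + vertexInd (a + 3)) := by
      convert reaches_toggle hG (by omega) (v := a + 2)
        (lab := vertexInd a + vertexInd (a + 2)) ?_ using 1
      · rw [e2, e3]
        funext w
        simp only [Pi.add_apply]
        grind
      · simp only [Pi.add_apply, vertexInd_apply]; grind
    refine hnext.winnable ?_
    have hshift := reaches_shift_iterate hG hn (q := a + 3)
      (μ := vertexInd a + vertexInd (a + 1)) ((n - 4) / 3) ?_
    · have he : a + 3 + ((3 * ((n - 4) / 3) : ℕ) : ZMod n) = a - 1 := by
        have h : ((3 * ((n - 4) / 3) + 4 : ℕ) : ZMod n) = 0 := by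
          rw [show 3 * ((n - 4) / 3) + 4 = n by omega, ZMod.natCast_self]
        rw [Nat.cast_add] at h
        push_cast at h ⊢
        linear_combination h
      rw [he] at hshift
      refine hshift.winnable ?_
      have ht := reaches_toggle hG (by omega) (v := a)
        (lab := vertexInd a + vertexInd (a + 1) + vertexInd (a - 1)) (by
          simp only [Pi.add_apply, vertexInd_apply]; grind)
      rwa [CharTwo.add_self_eq_zero] at ht
    · intro i hi
      have f1 := hfar 3 i (by omega) (by omega)
      have f2 := hfar 2 i (by omega) (by omega)
      have f3 : a + 3 + (i : ZMod n) ≠ a + 1 := by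
        intro h; apply f2; push_cast; linear_combination h
      push_cast at f1
      simp [vertexInd_apply, f1, f3]
  · have hshift := reaches_shift_iterate hG hn (q := a + 2)
      (μ := vertexInd a) ((n - 2) / 3) ?_
    · have he : a + 2 + ((3 * ((n - 2) / 3) : ℕ) : ZMod n) = a := by
        have h : ((3 * ((n - 2) / 3) + 2 : ℕ) : ZMod n) = 0 := by
          rw [show 3 * ((n - 2) / 3) + 2 = n by omega, ZMod.natCast_self]
        rw [Nat.cast_add] at h
        push_cast at h ⊢
        linear_combination h
      rw [he, CharTwo.add_self_eq_zero] at hshift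
      exact hshift
    · intro i hi
      have f := hfar 2 i (by omega) (by omega)
      push_cast at f
      simp [vertexInd_apply, f]

theorem gWinnable_of_window (hG : IsCycleOn G) (hn : 4 ≤ n) (h3 : n % 3 = 1 ∨ n % 3 = 2)
    {b : ZMod n} {lab : ZMod n → ZMod 2}
    (h : ∀ w, w ≠ b → w ≠ b + 1 → w ≠ b + 2 → lab w = 0) : gWinnable G lab := by
  have hne := offset_ne hn b
  obtain ⟨e1, e2, e3, e4⟩ := offset_eq b
  have hwin : ∀ v, gWinnable G (vertexInd v) := fun v => by
    simpa using gWinnable_vertexInd hG hn h3 (v - 1)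
  have h01 : ∀ x : ZMod 2, x = 0 ∨ x = 1 := by decide
  have hlab : lab = lab b • vertexInd b + lab (b + 1) • vertexInd (b + 1)
      + lab (b + 2) • vertexInd (b + 2) := by
    funext w
    simp only [Pi.add_apply, Pi.smul_apply, vertexInd_apply, smul_eq_mul]
    grind
  have hmid : ∀ μ, μ (b + 1) = 1 →
      gWinnable G (μ + (vertexInd (b + 1) + vertexInd (b + 2) + vertexInd b)) →
      gWinnable G μ := fun μ hμ hw => by
    have ht := reaches_toggle hG (by omega) hμ
    rw [e1, e4] at ht
    exact ht.winnable hw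
  have hzero : gWinnable G (0 : ZMod n → ZMod 2) := ⟨[], rfl⟩
  rcases h01 (lab b) with x0 | x0 <;> rcases h01 (lab (b + 1)) with x1 | x1 <;>
    rcases h01 (lab (b + 2)) with x2 | x2 <;>
    rw [x0, x1, x2] at hlab <;> simp only [zero_smul, one_smul, zero_add, add_zero] at hlab <;>
    subst hlab
  · exact hzero
  · exact hwin _
  · exact hwin _
  · refine hmid _ x1 ?_
    convert hwin b using 1
    funext w; simp only [Pi.add_apply]; grind
  · exact hwin _
  · have ht := reaches_toggle hG (by omega) x2
    rw [e2, e3] at ht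
    refine ht.winnable (hmid _ ?_ ?_)
    · simp only [Pi.add_apply, vertexInd_apply]; grind
    · have ht' := reaches_toggle hG (by omega) (v := b + 2)
        (lab := vertexInd (b + 2) + vertexInd (b + 3)) (by
          simp only [Pi.add_apply, vertexInd_apply]; grind)
      rw [e2, e3] at ht'
      convert ht'.winnable ?_ using 1
      · funext w; simp only [Pi.add_apply]; grind
      · convert hwin (b + 1) using 1
        funext w; simp only [Pi.add_apply]; grind
  · refine hmid _ x1 ?_
    convert hwin (b + 2) using 1
    funext w; simp only [Pi.add_apply]; grind
  · refine hmid _ x1 ?_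
    convert hzero using 1
    funext w; simp only [Pi.add_apply, Pi.zero_apply]; grind

theorem gAW_two_of_not_three_dvd (hG : IsCycleOn G) (hn : 4 ≤ n)
    (h3 : n % 3 = 1 ∨ n % 3 = 2) : gAW G 2 := by
  have : NeZero n := ⟨by omega⟩
  intro lab
  obtain ⟨μ, hμ, hμ0⟩ := exists_reaches_sweep hG hn lab (n - 3) (by omega)
  refine hμ.winnable (gWinnable_of_window hG hn h3 (b := ((n - 3 : ℕ) : ZMod n)) ?_)
  intro w w0 w1 w2
  rw [← ZMod.natCast_zmod_val w] at w0 w1 w2 ⊢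
  have hlt := ZMod.val_lt w
  apply hμ0
  by_contra hge
  obtain h | h | h : w.val = n - 3 ∨ w.val = n - 3 + 1 ∨ w.val = n - 3 + 2 := by omega
  · exact w0 (by rw [h])
  · exact w1 (by rw [h]; push_cast; rfl)
  · exact w2 (by rw [h]; push_cast; rfl)

end Cycle

theorem stmt18 (n k : ℕ) (hn : 3 ≤ n) (hk : 1 ≤ k) :
    gAW (SimpleGraph.cycleGraph n) (2 ^ k) ↔ (n % 3 = 1 ∨ n % 3 = 2) := by
  obtain ⟨m, rfl⟩ : ∃ m, n = m + 2 := ⟨n - 2, by omega⟩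
  have hG : IsCycleOn (n := m + 2) (SimpleGraph.cycleGraph (m + 2)) :=
    fun u v => SimpleGraph.cycleGraph_adj (n := m) (u := u) (v := v)
  constructor
  · intro h
    by_contra h3
    exact not_gAW_of_three_dvd hG hn (by omega) (gAW_two_of_gAW_two_pow hk h)
  · intro h3
    exact gAW_two_pow_of_gAW_two (gAW_two_of_not_three_dvd hG (by omega) h3) k
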